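/- arXiv:math/0701446 — 3 statements merged into one kernel-verified Lean document; each statement's English description precedes it below -/
import Mathlib

section
/- Let d be a positive integer, β > 0, and (h_n)_{n≥1} a sequence of positive real numbers with h_n → 0. Assume there exist C > 0 and n₀ ∈ ℕ such that for all n ≥ n₀, √(|log h_n| / (n · h_n^d)) ≤ C (log n / n)^{β/(2β+d)}. Then there exists C' > 0 such that for all n ≥ 2, h_n^{-1} ≤ C' (n / log n)^{1/(2β+d)}. -/
open MeasureTheory Real Filter

lemma log_le_sqrt_self {x : ℝ} (hx : 0 < x) : Real.log x ≤ √x := by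
  have hs : 0 < √x := Real.sqrt_pos.2 hx
  have h1 : Real.log (√x / 2) ≤ √x / 2 - 1 := Real.log_le_sub_one_of_pos (by positivity)
  rw [Real.log_div hs.ne' two_ne_zero, Real.log_sqrt hx.le] at h1
  linarith [Real.log_two_lt_d9]

lemma log_le_two_mul_log_div_log {x : ℝ} (hx : 1 < x) :
    Real.log x ≤ 2 * Real.log (x / Real.log x) := by
  have hlog : 0 < Real.log x := Real.log_pos hx
  have hx0 : 0 < x := by linarith
  have h1 := Real.log_le_log hlog (log_le_sqrt_self hx0)
  rw [Real.log_sqrt hx0.le] at h1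
  rw [Real.log_div hx0.ne' hlog.ne']
  linarith

/-- A bandwidth whose standard deviation term is at most `C` times the rate has an inverse bounded
by an explicit multiple of `(x / log x) ^ (1 / (2 * β + d))`. -/
lemma inv_bandwidth_le {d : ℕ} (hd : 0 < d) {β : ℝ} (hβ : 0 < β) {C x η : ℝ}
    (hx : 1 < x) (hη : 0 < η)
    (hbound : √(|Real.log η| / (x * η ^ d)) ≤ C * (Real.log x / x) ^ (β / (2 * β + d))) :
    η⁻¹ ≤ max 1 (2 * (2 * β + d) * C ^ 2) * (x / Real.log x) ^ (1 / (2 * β + d)) := by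
  have hs : 0 < 2 * β + d := by positivity
  set s := 2 * β + d with hs_def
  set M := max 1 (2 * s * C ^ 2)
  have hM : 1 ≤ M := le_max_left _ _
  have hlog : 0 < Real.log x := Real.log_pos hx
  have hx0 : 0 < x := by linarith
  have ht : 0 < x / Real.log x := by positivity
  set t := x / Real.log x with ht_def
  have hb : 0 < t ^ (1 / s) := by positivity
  rcases le_total η⁻¹ (t ^ (1 / s)) with hle | hge
  · exact hle.trans (le_mul_of_one_le_left hb.le hM)
  have hL : Real.log x ≤ 2 * s * |Real.log η| := by
    have h1 := Real.log_le_log hb hge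
    rw [Real.log_rpow ht, Real.log_inv, one_div, inv_mul_le_iff₀ hs] at h1
    have h2 := mul_le_mul_of_nonneg_left (neg_le_abs (Real.log η)) hs.le
    linarith [log_le_two_mul_log_div_log hx]
  have hrate : t * ((Real.log x / x) ^ (β / s)) ^ 2 = (t ^ (1 / s)) ^ d := by
    have hinv : Real.log x / x = t⁻¹ := by rw [ht_def, inv_div]
    rw [hinv, Real.inv_rpow ht.le, ← Real.rpow_neg ht.le, ← Real.rpow_mul_natCast ht.le,
      ← Real.rpow_mul_natCast ht.le]
    nth_rewrite 1 [← Real.rpow_one t]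
    rw [← Real.rpow_add ht]
    congr 1
    field_simp
    push_cast
    rw [hs_def]
    ring
  have hsq : |Real.log η| / (x * η ^ d) ≤ C ^ 2 * ((Real.log x / x) ^ (β / s)) ^ 2 := by
    have h1 := pow_le_pow_left₀ (Real.sqrt_nonneg _) hbound 2
    rwa [Real.sq_sqrt (by positivity), mul_pow] at h1
  have hpow : (η⁻¹) ^ d ≤ 2 * s * C ^ 2 * (t ^ (1 / s)) ^ d :=
    calc (η⁻¹) ^ d = t * (Real.log x / (x * η ^ d)) := by
          rw [ht_def, inv_pow]
          field_simp
      _ ≤ t * (2 * s * |Real.log η| / (x * η ^ d)) := by gcongr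
      _ = 2 * s * t * (|Real.log η| / (x * η ^ d)) := by ring
      _ ≤ 2 * s * t * (C ^ 2 * ((Real.log x / x) ^ (β / s)) ^ 2) := by gcongr
      _ = 2 * s * C ^ 2 * (t ^ (1 / s)) ^ d := by rw [← hrate]; ring
  refine le_of_pow_le_pow_left₀ hd.ne' (by positivity) (hpow.trans ?_)
  rw [mul_pow]
  gcongr
  exact (le_max_right _ _).trans (le_self_pow₀ hM hd.ne')

/-- Inequality up to a constant along a sequence only has to be checked eventually. -/
lemma exists_pos_forall_le_mul_of_forall_ge {p : ℕ → Prop} {f g : ℕ → ℝ} {M : ℝ} (hM : 0 < M)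
    (N : ℕ) (hg : ∀ n, p n → 0 < g n) (hfg : ∀ n, p n → N ≤ n → f n ≤ M * g n) :
    ∃ K : ℝ, 0 < K ∧ ∀ n, p n → f n ≤ K * g n := by
  have hsum : 0 ≤ ∑ i ∈ Finset.range N, |f i / g i| := Finset.sum_nonneg fun _ _ => abs_nonneg _
  refine ⟨M + ∑ i ∈ Finset.range N, |f i / g i|, by positivity, fun n hn => ?_⟩
  rcases le_or_gt N n with hN | hN
  · exact (hfg n hn hN).trans
      (mul_le_mul_of_nonneg_right (le_add_of_nonneg_right hsum) (hg n hn).le)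
  · rw [← div_le_iff₀ (hg n hn)]
    have h1 := Finset.single_le_sum (f := fun i => |f i / g i|) (fun _ _ => abs_nonneg _)
      (Finset.mem_range.2 hN)
    linarith [le_abs_self (f n / g n)]

/-- Deterministic sequence lemma (inequality (5) in Theorem 1): if the standard deviation term
`√(|log h_n|/(n h_n^d))` is dominated by the rate `(log n/n)^{β/(2β+d)}`, then the bandwidth
`h_n` cannot tend to `0` faster than `(log n/n)^{1/(2β+d)}`. -/
theorem bandwidth_lower_bound (d : ℕ) (hd : 0 < d) (β : ℝ) (hβ : 0 < β)
    (h : ℕ → ℝ) (hpos : ∀ n, 1 ≤ n → 0 < h n)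
    (hlim : Tendsto h atTop (nhds 0))
    (C : ℝ) (hC : 0 < C) (n₀ : ℕ)
    (hbound : ∀ n, n₀ ≤ n →
      Real.sqrt (|Real.log (h n)| / (n * h n ^ d)) ≤
        C * (Real.log n / n) ^ (β / (2 * β + d))) :
    ∃ C' : ℝ, 0 < C' ∧ ∀ n, 2 ≤ n →
      (h n)⁻¹ ≤ C' * ((n : ℝ) / Real.log n) ^ (1 / (2 * β + d)) := by
  have hone : ∀ n : ℕ, 2 ≤ n → (1 : ℝ) < n := fun n hn => by exact_mod_cast hn
  refine exists_pos_forall_le_mul_of_forall_ge (lt_max_of_lt_left one_pos) n₀ (fun n hn => ?_)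
    fun n hn hN => inv_bandwidth_le hd hβ (hone n hn) (hpos n (by lia)) (hbound n hN)
  have hlog : 0 < Real.log n := Real.log_pos (hone n hn)
  have hn0 : (0 : ℝ) < n := by linarith [hone n hn]
  positivity
end

section
/- Let d ≥ 1, β > 0, and N = ⌈β⌉ the smallest integer strictly greater than β. Let K ∈ K(N), let (h_n)_{n≥1} ∈ H, and let f : ℝ^d → ℝ be a bounded measurable 1-periodic function such that sup_{n≥1} h_n^{-β} ‖K_{h_n} * f - f‖_∞ < ∞. Then f belongs to B^β_{∞,∞} in the approximation sense. -/
open MeasureTheory Real ENNReal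

noncomputable section

/-- The rescaled kernel `K_h(t) = h^{-d} K(t/h)`. -/
def resKer (d : ℕ) (K : EuclideanSpace ℝ (Fin d) → ℝ) (h : ℝ) :
    EuclideanSpace ℝ (Fin d) → ℝ :=
  fun t => (h ^ d)⁻¹ * K (h⁻¹ • t)

/-- Convolution `(g * f)(t) = ∫ g(t-u) f(u) du` on `ℝ^d`. -/
def convol (d : ℕ) (g f : EuclideanSpace ℝ (Fin d) → ℝ) :
    EuclideanSpace ℝ (Fin d) → ℝ :=
  fun t => ∫ u, g (t - u) * f u

/-- The sup-norm `‖f‖_∞` (essential supremum of `|f|` over `ℝ^d`), with values in `ℝ≥0∞`. -/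
def supNorm (d : ℕ) (f : EuclideanSpace ℝ (Fin d) → ℝ) : ℝ≥0∞ :=
  eLpNorm f ⊤ volume

/-- `f` is 1-periodic: `f(x + e_i) = f(x)` for every standard basis vector `e_i`. -/
def Per1 (d : ℕ) (f : EuclideanSpace ℝ (Fin d) → ℝ) : Prop :=
  ∀ x (i : Fin d), f (x + EuclideanSpace.single i 1) = f x

/-- `f` is bounded and measurable. -/
def BddMeas (d : ℕ) (f : EuclideanSpace ℝ (Fin d) → ℝ) : Prop :=
  Measurable f ∧ ∃ M, ∀ x, |f x| ≤ M

/-- The partial derivative `∂f/∂t_i`. -/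
def pderiv1 (d : ℕ) (i : Fin d) (f : EuclideanSpace ℝ (Fin d) → ℝ) :
    EuclideanSpace ℝ (Fin d) → ℝ :=
  fun x => fderiv ℝ f x (EuclideanSpace.single i 1)

/-- The partial derivative `∂^α f = ∂^{α_1}_{t_1} ⋯ ∂^{α_d}_{t_d} f` for a multi-index `α`. -/
def pderivM (d : ℕ) (α : Fin d → ℕ) (f : EuclideanSpace ℝ (Fin d) → ℝ) :
    EuclideanSpace ℝ (Fin d) → ℝ :=
  (List.finRange d).foldr (fun i g => (pderiv1 d i)^[α i] g) f

/-- The kernel class `K(N)`: conditions (A1)–(A6) of the paper. -/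
def KernelClass (d N : ℕ) (K : EuclideanSpace ℝ (Fin d) → ℝ) : Prop :=
  -- (A1) compact support
  HasCompactSupport K ∧
  -- (A2) square-integrable
  Integrable (fun u => K u ^ 2) ∧
  -- (A3) L² increment bound
  (∃ C > 0, ∃ γ ∈ Set.Ioc (0 : ℝ) 1, ∀ t : EuclideanSpace ℝ (Fin d), ‖t‖ ≤ 1 →
    ∫ u, (K (t + u) - K u) ^ 2 ≤ C * ‖t‖ ^ (2 * γ)) ∧
  -- (A4) unit mass
  (∫ u, K u) = 1 ∧
  -- (A5) smoothness and integrable partial derivatives up to order N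
  (ContDiff ℝ N K ∧ ∀ α : Fin d → ℕ, (∑ i, α i) ≤ N →
    Integrable (fun t => |pderivM d α K t|)) ∧
  -- (A6) vanishing moments
  (∀ α : Fin d → ℕ, 1 ≤ (∑ i, α i) → (∑ i, α i) ≤ N →
    ∫ u, (∏ i, u i ^ α i) * K u = 0)

/-- The bandwidth class `H`: `h_n = 2^{-m_n}` with `(m_n)` nondecreasing positive integers
tending to `∞` and with bounded increments. -/
def BandClass (h : ℕ → ℝ) : Prop :=
  ∃ m : ℕ → ℕ, (∀ n, 0 < m n) ∧ Monotone m ∧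
    Filter.Tendsto m Filter.atTop Filter.atTop ∧
    (∃ B : ℕ, ∀ n, m (n + 1) - m n ≤ B) ∧
    ∀ n, h n = (2 : ℝ) ^ (-(m n : ℝ))

/-- `f` belongs to the Besov space `B^β_{∞,∞}` in the approximation sense: there are bounded
1-periodic `C^N` functions `f_j` with `sup_j 2^{jβ} ‖f - f_j‖_∞ < ∞` and
`sup_j 2^{-(N-β)j} ‖∂^α f_j‖_∞ < ∞` for every multi-index `α` with `|α| = N`. -/
def MemBesov (d : ℕ) (β : ℝ) (N : ℕ) (f : EuclideanSpace ℝ (Fin d) → ℝ) : Prop :=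
  ∃ fs : ℕ → EuclideanSpace ℝ (Fin d) → ℝ,
    (∀ j, 1 ≤ j → (∃ M, ∀ x, |fs j x| ≤ M) ∧ Per1 d (fs j) ∧ ContDiff ℝ N (fs j)) ∧
    (∃ C : ℝ, ∀ j : ℕ, 1 ≤ j →
      supNorm d (fun x => f x - fs j x) ≤ ENNReal.ofReal (C * 2 ^ (-(j : ℝ) * β))) ∧
    (∃ C : ℝ, ∀ α : Fin d → ℕ, (∑ i, α i) = N → ∀ j : ℕ, 1 ≤ j →
      supNorm d (pderivM d α (fs j)) ≤ ENNReal.ofReal (C * 2 ^ (((N : ℝ) - β) * j)))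

/-- The Hölder class `Σ(β)`: `f` is a bounded 1-periodic function of class `C^m`
(`m` the largest integer strictly less than `β`) all of whose partial derivatives of order `m`
are `(β-m)`-Hölder. -/
def HolderSigma (d : ℕ) (β : ℝ) (f : EuclideanSpace ℝ (Fin d) → ℝ) : Prop :=
  ∃ m : ℕ, (m : ℝ) < β ∧ β ≤ (m : ℝ) + 1 ∧
    ContDiff ℝ m f ∧ (∃ M, ∀ x, |f x| ≤ M) ∧ Per1 d f ∧
    ∀ σ : Fin d → ℕ, (∑ i, σ i) = m → ∃ C : ℝ, ∀ x y,
      |pderivM d σ f x - pderivM d σ f y| ≤ C * ‖x - y‖ ^ (β - (m : ℝ))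

end

open scoped Convolution

/-- Relations between functions that are preserved by simultaneous partial differentiation, raising
the order by one, are preserved by `pderivM`. -/
theorem pderivM_induction {d : ℕ}
    (P : ℕ → (EuclideanSpace ℝ (Fin d) → ℝ) → (EuclideanSpace ℝ (Fin d) → ℝ) → Prop)
    (step : ∀ n g g' i, P n g g' → P (n + 1) (pderiv1 d i g) (pderiv1 d i g'))
    {g g' : EuclideanSpace ℝ (Fin d) → ℝ} (h0 : P 0 g g') (α : Fin d → ℕ) :
    P (∑ i, α i) (pderivM d α g) (pderivM d α g') := by
  have iter : ∀ i m n u u', P n u u' →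
      P (n + m) ((pderiv1 d i)^[m] u) ((pderiv1 d i)^[m] u') := by
    intro i m
    induction m with
    | zero => intro n u u' hu; simpa using hu
    | succ m ih =>
      intro n u u' hu
      rw [Function.iterate_succ_apply', Function.iterate_succ_apply', ← add_assoc]
      exact step _ _ _ _ (ih n u u' hu)
  have key : ∀ l : List (Fin d), P (l.map α).sum
      (l.foldr (fun i u => (pderiv1 d i)^[α i] u) g)
      (l.foldr (fun i u => (pderiv1 d i)^[α i] u) g') := by
    intro l
    induction l with
    | nil => simpa using h0
    | cons i l ih =>
      rw [List.map_cons, List.sum_cons, add_comm]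
      exact iter _ _ _ _ _ ih
  rw [Fin.sum_univ_def]
  exact key _

theorem contDiff_pderiv1 {d n : ℕ} {g : EuclideanSpace ℝ (Fin d) → ℝ}
    (hg : ContDiff ℝ (n + 1 : ℕ) g) (i : Fin d) : ContDiff ℝ n (pderiv1 d i g) :=
  (hg.fderiv_right (m := n) (by norm_cast)).clm_apply contDiff_const

theorem hasCompactSupport_pderiv1 {d : ℕ} {g : EuclideanSpace ℝ (Fin d) → ℝ}
    (hg : HasCompactSupport g) (i : Fin d) : HasCompactSupport (pderiv1 d i g) :=
  hg.fderiv_apply ℝ _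

theorem convol_eq_convolution {d : ℕ} (g f : EuclideanSpace ℝ (Fin d) → ℝ) :
    convol d g f = f ⋆[ContinuousLinearMap.mul ℝ ℝ, volume] g := by
  funext t
  simp only [convol, convolution_def, ContinuousLinearMap.mul_apply', mul_comm]

theorem BddMeas.locallyIntegrable {d : ℕ} {f : EuclideanSpace ℝ (Fin d) → ℝ}
    (hf : BddMeas d f) : LocallyIntegrable f volume := by
  obtain ⟨hm, M, hM⟩ := hf
  exact (locallyIntegrable_const M).mono hm.aestronglyMeasurable
    (.of_forall fun x => (hM x).trans (le_abs_self M))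

theorem contDiff_convol {d n : ℕ} {g f : EuclideanSpace ℝ (Fin d) → ℝ}
    (hcg : HasCompactSupport g) (hg : ContDiff ℝ n g) (hf : LocallyIntegrable f volume) :
    ContDiff ℝ n (convol d g f) := by
  rw [convol_eq_convolution]
  exact hcg.contDiff_convolution_right (n := (n : ℕ∞)) _ hf hg

theorem pderiv1_convol {d : ℕ} {g f : EuclideanSpace ℝ (Fin d) → ℝ}
    (hcg : HasCompactSupport g) (hg : ContDiff ℝ 1 g) (hf : LocallyIntegrable f volume)
    (i : Fin d) : pderiv1 d i (convol d g f) = convol d (pderiv1 d i g) f := by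
  funext x
  rw [convol_eq_convolution, convol_eq_convolution, pderiv1,
    (hcg.hasFDerivAt_convolution_right _ hf hg x).fderiv,
    convolution_precompR_apply _ hf (hcg.fderiv ℝ) (hg.continuous_fderiv one_ne_zero)]
  rfl

theorem pderivM_convol {d N : ℕ} {g f : EuclideanSpace ℝ (Fin d) → ℝ}
    (hcg : HasCompactSupport g) (hg : ContDiff ℝ N g) (hf : LocallyIntegrable f volume)
    {α : Fin d → ℕ} (hα : ∑ i, α i = N) :
    HasCompactSupport (pderivM d α g) ∧ Continuous (pderivM d α g) ∧
      pderivM d α (convol d g f) = convol d (pderivM d α g) f := by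
  have := pderivM_induction (fun n u u' => n ≤ N → HasCompactSupport u ∧
    ContDiff ℝ (N - n : ℕ) u ∧ u' = convol d u f) (fun n u u' i ih hn => by
      obtain ⟨h1, h2, rfl⟩ := ih (by omega)
      obtain ⟨m, hm⟩ : ∃ m, N - n = m + 1 := ⟨N - n - 1, by omega⟩
      rw [hm] at h2
      refine ⟨hasCompactSupport_pderiv1 h1 i, ?_, pderiv1_convol h1 (h2.of_le ?_) hf i⟩
      · rw [show N - (n + 1) = m by omega]
        exact contDiff_pderiv1 h2 i
      · norm_cast
        omega) (fun _ => ⟨hcg, by simpa using hg, rfl⟩) α hα.le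
  exact ⟨this.1, this.2.1.continuous, this.2.2⟩

theorem pderivM_resKer {d : ℕ} (K : EuclideanSpace ℝ (Fin d) → ℝ) (s : ℝ) (α : Fin d → ℕ) :
    pderivM d α (resKer d K s) =
      fun t => (s⁻¹) ^ (∑ i, α i) * resKer d (pderivM d α K) s t := by
  refine pderivM_induction (fun n u u' => u' = fun t => (s⁻¹) ^ n * resKer d u s t)
    (fun n u u' i ih => ?_) (by simp) α
  subst ih
  funext t
  have e : (fun t => s⁻¹ ^ n * resKer d u s t) =
      (s⁻¹ ^ n * (s ^ d)⁻¹) • fun t => u (s⁻¹ • t) := by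
    funext t
    simp [resKer, mul_assoc]
  rw [pderiv1, e, fderiv_const_smul_field, Pi.smul_apply, fderiv_comp_smul]
  simp only [smul_apply, smul_eq_mul, resKer, pderiv1]
  ring

theorem integral_abs_resKer {d : ℕ} (G : EuclideanSpace ℝ (Fin d) → ℝ) {s : ℝ} (hs : 0 < s) :
    ∫ t, |resKer d G s t| = ∫ t, |G t| := by
  have : (fun t => |resKer d G s t|) = fun t => (s ^ d)⁻¹ * |G (s⁻¹ • t)| := by
    funext t
    rw [resKer, abs_mul, abs_of_pos (by positivity)]
  rw [this, integral_const_mul,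
    Measure.integral_comp_inv_smul_of_nonneg volume (fun t => |G t|) hs.le,
    finrank_euclideanSpace_fin, smul_eq_mul, inv_mul_cancel_left₀ (by positivity)]

theorem hasCompactSupport_resKer {d : ℕ} {K : EuclideanSpace ℝ (Fin d) → ℝ}
    (hK : HasCompactSupport K) {s : ℝ} (hs : 0 < s) : HasCompactSupport (resKer d K s) :=
  (hK.comp_smul (inv_ne_zero hs.ne')).mul_left (f := fun _ => (s ^ d)⁻¹)

theorem contDiff_resKer {d n : ℕ} {K : EuclideanSpace ℝ (Fin d) → ℝ}
    (hK : ContDiff ℝ n K) (s : ℝ) : ContDiff ℝ n (resKer d K s) :=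
  contDiff_const.mul (hK.comp (contDiff_const_smul _))

theorem abs_convol_le {d : ℕ} {k w : EuclideanSpace ℝ (Fin d) → ℝ} (hk : Integrable k)
    {M : ℝ} (hw : ∀ᵐ u, |w u| ≤ M) (t : EuclideanSpace ℝ (Fin d)) :
    |convol d k w t| ≤ (∫ u, |k u|) * M := by
  rw [← integral_sub_left_eq_self (fun u => |k u|) volume t, ← integral_mul_const]
  refine norm_integral_le_of_norm_le (f := fun u => k (t - u) * w u) ((hk.comp_sub_left t).abs.mul_const M) ?_
  filter_upwards [hw] with u hu
  rw [norm_mul]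
  exact mul_le_mul_of_nonneg_left hu (abs_nonneg _)

theorem convol_sub {d : ℕ} {k f g : EuclideanSpace ℝ (Fin d) → ℝ} (hk : Integrable k)
    (hf : BddMeas d f) (hg : BddMeas d g) (t : EuclideanSpace ℝ (Fin d)) :
    convol d k (fun u => f u - g u) t = convol d k f t - convol d k g t := by
  have hi : ∀ w, BddMeas d w → Integrable fun u => k (t - u) * w u := fun w hw =>
    (hk.comp_sub_left t).mul_bdd (c := hw.2.choose) hw.1.aestronglyMeasurable
      (.of_forall hw.2.choose_spec)
  simp only [convol, mul_sub]
  exact integral_sub (hi f hf) (hi g hg)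

theorem convol_comm {d : ℕ} {k l f : EuclideanSpace ℝ (Fin d) → ℝ}
    (hck : HasCompactSupport k) (hk : Continuous k) (hcl : HasCompactSupport l)
    (hl : Continuous l) (hf : LocallyIntegrable f volume) :
    convol d k (convol d l f) = convol d l (convol d k f) := by
  have key : ∀ k l : EuclideanSpace ℝ (Fin d) → ℝ, HasCompactSupport k → Continuous k →
      HasCompactSupport l → Continuous l → convol d k (convol d l f) =
        f ⋆[ContinuousLinearMap.mul ℝ ℝ, volume] (l ⋆[ContinuousLinearMap.mul ℝ ℝ, volume] k) := by
    intro k l hck hk hcl hl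
    rw [convol_eq_convolution, convol_eq_convolution]
    funext x
    refine convolution_assoc _ _ _ _ (fun x y z => mul_assoc x y z) hf.aestronglyMeasurable
      hl.aestronglyMeasurable hk.aestronglyMeasurable
      (.of_forall (hcl.convolutionExists_right _ hf hl))
      (.of_forall (hck.norm.convolutionExists_right _ hl.norm.locallyIntegrable hk.norm)) ?_
    exact (hcl.norm.convolution _ hck.norm).convolutionExists_right _ (fun y => (hf y).norm)
      (hck.norm.continuous_convolution_right _ hl.norm.locallyIntegrable hk.norm) x
  rw [key k l hck hk hcl hl, key l k hcl hl hck hk]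
  congr 1
  funext x
  rw [convolution_mul_swap, convolution_def]
  simp only [ContinuousLinearMap.mul_apply', mul_comm]

theorem per1_convol {d : ℕ} {f : EuclideanSpace ℝ (Fin d) → ℝ} (hf : Per1 d f)
    (k : EuclideanSpace ℝ (Fin d) → ℝ) : Per1 d (convol d k f) := by
  intro x i
  simp only [convol]
  rw [← integral_add_right_eq_self _ (EuclideanSpace.single i 1)]
  simp only [add_sub_add_right_eq_sub, hf _ i]

theorem supNorm_le_of_ae {d : ℕ} {f : EuclideanSpace ℝ (Fin d) → ℝ} {c : ℝ}
    (hf : ∀ᵐ x, |f x| ≤ c) : supNorm d f ≤ ENNReal.ofReal c := by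
  rw [supNorm, eLpNorm_exponent_top]
  exact eLpNormEssSup_le_of_ae_bound hf

theorem ae_le_of_supNorm_le {d : ℕ} {f : EuclideanSpace ℝ (Fin d) → ℝ} {c : ℝ} (hc : 0 ≤ c)
    (hf : supNorm d f ≤ ENNReal.ofReal c) : ∀ᵐ x, |f x| ≤ c := by
  rw [supNorm, eLpNorm_exponent_top] at hf
  filter_upwards [ae_le_eLpNormEssSup (f := f) (μ := volume)] with x hx
  rw [← Real.norm_eq_abs, ← ENNReal.ofReal_le_ofReal_iff hc, ofReal_norm]
  exact hx.trans hf

/-- A sequence of positive integers tending to infinity with bounded increments meets every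
window `[j, j + B]` for some `B`. -/
theorem exists_index_window {m : ℕ → ℕ} (htop : Filter.Tendsto m Filter.atTop Filter.atTop)
    {B : ℕ} (hB : ∀ n, m (n + 1) - m n ≤ B) (j : ℕ) :
    ∃ n, 1 ≤ n ∧ j ≤ m n ∧ m n ≤ j + (B + m 1) := by
  classical
  have hex : ∃ n, j ≤ m (n + 1) := by
    obtain ⟨n, hn⟩ := ((htop.eventually_ge_atTop j).and (Filter.eventually_ge_atTop 1)).exists
    exact ⟨n - 1, by rw [Nat.sub_add_cancel hn.2]; exact hn.1⟩
  refine ⟨Nat.find hex + 1, by omega, Nat.find_spec hex, ?_⟩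
  rcases hn : Nat.find hex with _ | n
  · simp only [zero_add]
    omega
  · have h1 := Nat.find_min hex (m := n) (by omega)
    have h2 := hB (n + 1)
    omega

theorem integrable_pderivM_resKer {d N : ℕ} {K : EuclideanSpace ℝ (Fin d) → ℝ}
    (hcK : HasCompactSupport K) (hK : ContDiff ℝ N K) {α : Fin d → ℕ} (hα : ∑ i, α i = N)
    {s : ℝ} (hs : 0 < s) : Integrable (pderivM d α (resKer d K s)) :=
  have h := pderivM_convol (hasCompactSupport_resKer hcK hs) (contDiff_resKer hK s)
    (locallyIntegrable_const (0 : ℝ)) hα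
  h.2.1.integrable_of_hasCompactSupport h.1

theorem abs_convol_pderivM_resKer_le {d N : ℕ} {K w : EuclideanSpace ℝ (Fin d) → ℝ}
    (hcK : HasCompactSupport K) (hK : ContDiff ℝ N K) {α : Fin d → ℕ} (hα : ∑ i, α i = N)
    {s : ℝ} (hs : 0 < s) {M : ℝ} (hw : ∀ᵐ u, |w u| ≤ M) (t : EuclideanSpace ℝ (Fin d)) :
    |convol d (pderivM d α (resKer d K s)) w t| ≤
      (s⁻¹) ^ N * (∫ u, |pderivM d α K u|) * M := by
  refine (abs_convol_le (integrable_pderivM_resKer hcK hK hα hs) hw t).trans_eq ?_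
  simp only [pderivM_resKer, hα, abs_mul]
  rw [integral_const_mul, integral_abs_resKer _ hs, abs_of_pos (by positivity)]

/-- Derivatives of `K_s * f` in terms of those of `K_{s'} * f` and the distance from `K_{s'} * f`
to `f`. -/
theorem abs_pderivM_convol_resKer_le {d N : ℕ} {K f : EuclideanSpace ℝ (Fin d) → ℝ}
    (hcK : HasCompactSupport K) (hK : ContDiff ℝ N K) (hf : BddMeas d f)
    {α : Fin d → ℕ} (hα : ∑ i, α i = N) {s s' : ℝ} (hs : 0 < s) (hs' : 0 < s') {ε A : ℝ}
    (hε : ∀ᵐ u, |f u - convol d (resKer d K s') f u| ≤ ε)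
    (hA : ∀ t, |pderivM d α (convol d (resKer d K s') f) t| ≤ A)
    (t : EuclideanSpace ℝ (Fin d)) :
    |pderivM d α (convol d (resKer d K s) f) t| ≤
      (s⁻¹) ^ N * (∫ u, |pderivM d α K u|) * ε + (∫ u, |K u|) * A := by
  have hc := hasCompactSupport_resKer hcK hs
  have hc' := hasCompactSupport_resKer hcK hs'
  have hd := contDiff_resKer hK s
  have hd' := contDiff_resKer hK s'
  have hL := hf.locallyIntegrable
  obtain ⟨-, -, h1⟩ := pderivM_convol hc hd hL hα
  obtain ⟨hc2, hd2, h2⟩ := pderivM_convol hc' hd' hL hα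
  have hb : ∀ σ, 0 < σ → BddMeas d (convol d (resKer d K σ) f) := fun σ hσ =>
    have hcσ := hasCompactSupport_resKer hcK hσ
    have hdσ := contDiff_resKer hK σ
    ⟨(contDiff_convol hcσ hdσ hL).continuous.measurable, _, abs_convol_le
      (hdσ.continuous.integrable_of_hasCompactSupport hcσ) (.of_forall hf.2.choose_spec)⟩
  have h3 : convol d (pderivM d α (resKer d K s)) (convol d (resKer d K s') f) =
      convol d (resKer d K s) (pderivM d α (convol d (resKer d K s') f)) := by
    rw [← (pderivM_convol hc hd (hb s' hs').locallyIntegrable hα).2.2,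
      convol_comm hc hd.continuous hc' hd'.continuous hL,
      (pderivM_convol hc' hd' (hb s hs).locallyIntegrable hα).2.2,
      convol_comm hc2 hd2 hc hd.continuous hL, h2]
  have h4 := convol_sub (integrable_pderivM_resKer hcK hK hα hs) hf (hb s' hs') t
  rw [h1, eq_add_of_sub_eq h4.symm, h3]
  refine (abs_add_le _ _).trans
    (add_le_add (abs_convol_pderivM_resKer_le hcK hK hα hs hε t) ?_)
  rw [← integral_abs_resKer K hs]
  exact abs_convol_le (hd.continuous.integrable_of_hasCompactSupport hc) (.of_forall hA) t

/-- A family of bounds propagated over `r` steps with a multiplicative loss independent of `r`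
grows geometrically at rate `q`. -/
theorem exists_geometric_bound {p q κ E : ℝ} (hp : 1 ≤ p) (hq : 1 < q) (hE : 0 ≤ E) :
    ∃ A, ∀ Q : ℕ → ℝ → Prop, (∀ j x y, Q j x → x ≤ y → Q j y) →
      (∀ j, Q j (E * (q * p) ^ j)) →
      (∀ i r x, Q i x → Q (i + r) (E * p ^ r * q ^ (i + r) + κ * x)) →
      ∀ j, Q j (A * q ^ j) := by
  obtain ⟨r, hr⟩ := pow_unbounded_of_one_lt (max 1 (2 * κ)) hq
  have hr1 : 1 < q ^ r := (le_max_left _ _).trans_lt hr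
  have hrκ : 2 * κ < q ^ r := (le_max_right _ _).trans_lt hr
  have hr0 : r ≠ 0 := by rintro rfl; simp at hr1
  have hqp : 1 ≤ q * p := one_le_mul_of_one_le_of_one_le hq.le hp
  refine ⟨max (2 * (E * p ^ r)) (E * (q * p) ^ r), fun Q mono crude step j => ?_⟩
  set A := max (2 * (E * p ^ r)) (E * (q * p) ^ r)
  have hA1 : 2 * (E * p ^ r) ≤ A := le_max_left _ _
  have hA2 : E * (q * p) ^ r ≤ A := le_max_right _ _
  have hA0 : 0 ≤ A := le_trans (by positivity) hA1
  induction j using Nat.strong_induction_on with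
  | _ j ih =>
    rcases lt_or_ge j r with hj | hj
    · refine mono _ _ _ (crude j) ?_
      calc E * (q * p) ^ j ≤ E * (q * p) ^ r := by gcongr
        _ ≤ A := hA2
        _ ≤ A * q ^ j := le_mul_of_one_le_right hA0 (one_le_pow₀ hq.le)
    · obtain ⟨i, rfl⟩ := Nat.exists_eq_add_of_le' hj
      refine mono _ _ _ (step i r _ (ih i (by omega))) ?_
      have hqi : 0 < q ^ i := by positivity
      have h1 : E * p ^ r * q ^ (i + r) ≤ A / 2 * q ^ (i + r) := by
        gcongr
        linarith
      have h2 : κ * (A * q ^ i) ≤ q ^ r / 2 * (A * q ^ i) := by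
        gcongr
        linarith
      rw [pow_add] at h1 ⊢
      nlinarith

/-- Proposition 3 of the paper: if `K ∈ K(N)` with `N = ⌈β⌉` the smallest integer strictly
greater than `β`, `(h_n) ∈ H`, and `f` is a bounded measurable 1-periodic function with
`sup_n h_n^{-β} ‖K_{h_n} * f - f‖_∞ < ∞`, then `f ∈ B^β_{∞,∞}` in the approximation sense. -/
theorem besov_of_kernel_approx (d : ℕ) (hd : 1 ≤ d) (β : ℝ) (hβ : 0 < β)
    (N : ℕ) (hN : β < (N : ℝ) ∧ (N : ℝ) ≤ β + 1)
    (K : EuclideanSpace ℝ (Fin d) → ℝ) (hK : KernelClass d N K)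
    (h : ℕ → ℝ) (hh : BandClass h)
    (f : EuclideanSpace ℝ (Fin d) → ℝ) (hf : BddMeas d f) (hper : Per1 d f)
    (hbias : ∃ C : ℝ, ∀ n : ℕ, 1 ≤ n →
      supNorm d (fun t => convol d (resKer d K (h n)) f t - f t) ≤
        ENNReal.ofReal (C * h n ^ β)) :
    MemBesov d β N f := by
  obtain ⟨hcK, -, -, -, ⟨hdK, -⟩, -⟩ := hK
  obtain ⟨m, -, -, htop, ⟨B₀, hB₀⟩, hm⟩ := hh
  obtain ⟨C₀, hC₀⟩ := hbias
  have hL := hf.locallyIntegrable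
  obtain ⟨M, hM⟩ := hf.2
  have hM0 : 0 ≤ M := (abs_nonneg _).trans (hM 0)
  choose ν hν1 hν2 hν3 using exists_index_window htop hB₀
  set B := B₀ + m 1
  set C := max C₀ 0
  have hC0 : 0 ≤ C := le_max_right _ _
  have hs : ∀ j, 0 < h (ν j) := fun j => by rw [hm]; positivity
  have hsinv : ∀ j, (h (ν j))⁻¹ ≤ 2 ^ (j + B) := fun j => by
    rw [hm, Real.rpow_neg zero_le_two, inv_inv, Real.rpow_natCast]
    exact pow_le_pow_right₀ one_le_two (hν3 j)
  have hsβ : ∀ j, h (ν j) ^ β ≤ 2 ^ (-(j : ℝ) * β) := fun j => by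
    rw [hm, ← Real.rpow_mul zero_le_two]
    refine Real.rpow_le_rpow_of_exponent_le one_le_two ?_
    have : (j : ℝ) ≤ m (ν j) := by exact_mod_cast hν2 j
    nlinarith
  have hbias' : ∀ j : ℕ, ∀ᵐ x, |f x - convol d (resKer d K (h (ν j))) f x| ≤
      C * 2 ^ (-(j : ℝ) * β) := fun j => by
    have hle : C₀ * h (ν j) ^ β ≤ C * 2 ^ (-(j : ℝ) * β) :=
      mul_le_mul (le_max_left _ _) (hsβ j) (Real.rpow_nonneg (hs j).le _) hC0
    filter_upwards [ae_le_of_supNorm_le (by positivity)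
      ((hC₀ _ (hν1 j)).trans (ENNReal.ofReal_le_ofReal hle))] with x hx
    rwa [abs_sub_comm]
  refine ⟨fun j => convol d (resKer d K (h (ν j))) f, fun j _ => ⟨⟨_, abs_convol_le
    ((contDiff_resKer hdK _).continuous.integrable_of_hasCompactSupport
      (hasCompactSupport_resKer hcK (hs j))) (.of_forall hM)⟩, per1_convol hper _,
    contDiff_convol (hasCompactSupport_resKer hcK (hs j)) (contDiff_resKer hdK _) hL⟩,
    ⟨C, fun j _ => supNorm_le_of_ae (hbias' j)⟩, ?_⟩
  set Λ := ∑ α ∈ Finset.piAntidiag (Finset.univ : Finset (Fin d)) N, ∫ u, |pderivM d α K u|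
  have hΛ : ∀ α : Fin d → ℕ, ∑ i, α i = N → ∫ u, |pderivM d α K u| ≤ Λ := fun α hα =>
    Finset.single_le_sum (f := fun α => ∫ u, |pderivM d α K u|)
      (fun _ _ => integral_nonneg fun _ => abs_nonneg _) (by simp [hα])
  have hΛ0 : 0 ≤ Λ := Finset.sum_nonneg fun _ _ => integral_nonneg fun _ => abs_nonneg _
  set p : ℝ := 2 ^ β
  set q : ℝ := 2 ^ ((N : ℝ) - β)
  have hp : 1 < p := Real.one_lt_rpow one_lt_two hβ
  have hq : 1 < q := Real.one_lt_rpow one_lt_two (by linarith [hN.1])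
  have hqp : q * p = 2 ^ N := by
    rw [← Real.rpow_add two_pos, sub_add_cancel, Real.rpow_natCast]
  have hpj : ∀ j : ℕ, (2 : ℝ) ^ (-(j : ℝ) * β) = (p ^ j)⁻¹ := fun j => by
    rw [← Real.rpow_mul_natCast zero_le_two, ← Real.rpow_neg zero_le_two]
    congr 1
    ring
  have hsN : ∀ j, (h (ν j))⁻¹ ^ N ≤ 2 ^ (B * N) * (q * p) ^ j := fun j => by
    refine (pow_le_pow_left₀ (inv_nonneg.2 (hs j).le) (hsinv j) N).trans_eq ?_
    rw [hqp]
    ring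
  obtain ⟨A, hA⟩ := exists_geometric_bound (κ := ∫ u, |K u|)
    (E := 2 ^ (B * N) * Λ * max M C) hp.le hq (by positivity)
  refine ⟨A, fun α hα j _ => supNorm_le_of_ae (.of_forall ?_)⟩
  rw [Real.rpow_mul_natCast zero_le_two]
  have hI := hΛ α hα
  refine hA (fun j x => ∀ t, |pderivM d α (convol d (resKer d K (h (ν j))) f) t| ≤ x)
    (fun j x y hx hxy t => (hx t).trans hxy) (fun j t => ?_) (fun i r x hx t => ?_) j
  · rw [(pderivM_convol (hasCompactSupport_resKer hcK (hs j)) (contDiff_resKer hdK _) hL hα).2.2]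
    refine (abs_convol_pderivM_resKer_le hcK hdK hα (hs j) (.of_forall hM) t).trans ?_
    calc _ ≤ 2 ^ (B * N) * (q * p) ^ j * Λ * max M C := by
          gcongr
          · exact hsN j
          · exact le_max_left _ _
      _ = _ := by ring
  · refine (abs_pderivM_convol_resKer_le hcK hdK hf hα (hs (i + r)) (hs i) (hbias' i) hx t).trans
      (add_le_add_left ?_ _)
    rw [hpj]
    calc _ ≤ 2 ^ (B * N) * (q * p) ^ (i + r) * Λ * (max M C * (p ^ i)⁻¹) := by
          gcongr
          · exact hsN _
          · exact le_max_right _ _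
      _ = _ := by
          have : p ^ i ≠ 0 := by positivity
          rw [mul_pow, pow_add p]
          field_simp
end

section
/- Let 0 < β < 1 and let f : ℝ^d → ℝ be a continuous bounded 1-periodic function. Then f belongs to B^β_{∞,∞} in the approximation sense if and only if sup_{x≠y} |f(x) - f(y)| / ‖x-y‖^β < ∞. -/
open MeasureTheory Real ENNReal

open Convolution

theorem supNorm_le_ofReal {d : ℕ} {g : EuclideanSpace ℝ (Fin d) → ℝ} {c : ℝ}
    (h : ∀ x, |g x| ≤ c) : supNorm d g ≤ ENNReal.ofReal c := by
  rw [supNorm, eLpNorm_exponent_top]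
  exact eLpNormEssSup_le_of_ae_bound (Filter.Eventually.of_forall h)

theorem abs_le_of_supNorm_le_ofReal {d : ℕ} {g : EuclideanSpace ℝ (Fin d) → ℝ}
    (hg : Continuous g) {c : ℝ} (hc : 0 ≤ c) (h : supNorm d g ≤ ENNReal.ofReal c)
    (x : EuclideanSpace ℝ (Fin d)) : |g x| ≤ c := by
  rw [supNorm, eLpNorm_exponent_top] at h
  have hae : ∀ᵐ y, |g y| ≤ c := by
    filter_upwards [enorm_ae_le_eLpNormEssSup g volume] with y hy
    have hyc := hy.trans h
    rwa [← ofReal_norm, ENNReal.ofReal_le_ofReal_iff hc, Real.norm_eq_abs] at hyc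
  have hclosed : IsClosed {y | |g y| ≤ c} := isClosed_le hg.abs continuous_const
  have huniv := (Measure.dense_of_ae hae).closure_eq
  rw [hclosed.closure_eq] at huniv
  exact Set.eq_univ_iff_forall.1 huniv x

theorem foldr_pderiv1_single {d : ℕ} (i : Fin d) (f : EuclideanSpace ℝ (Fin d) → ℝ)
    (l : List (Fin d)) (hl : l.Nodup) :
    l.foldr (fun k g => (pderiv1 d k)^[(Pi.single i 1 : Fin d → ℕ) k] g) f =
      if i ∈ l then pderiv1 d i f else f := by
  induction l with
  | nil => simp
  | cons a l ih =>
    rw [List.nodup_cons] at hl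
    rw [List.foldr_cons, ih hl.2]
    by_cases h : a = i
    · subst h
      simp [hl.1]
    · simp [h, Ne.symm h]

theorem pderivM_single {d : ℕ} (i : Fin d) (f : EuclideanSpace ℝ (Fin d) → ℝ) :
    pderivM d (Pi.single i 1) f = pderiv1 d i f := by
  rw [pderivM, foldr_pderiv1_single i f _ (List.nodup_finRange d), if_pos (List.mem_finRange i)]

theorem exists_eq_single_of_sum_eq_one {d : ℕ} {α : Fin d → ℕ} (h : ∑ i, α i = 1) :
    ∃ i, α = Pi.single i 1 := by
  obtain ⟨i, -, hi⟩ := Finset.exists_ne_zero_of_sum_ne_zero (by omega : ∑ i, α i ≠ 0)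
  have hsum := Finset.add_sum_erase Finset.univ α (Finset.mem_univ i)
  refine ⟨i, funext fun k => ?_⟩
  by_cases hk : k = i
  · subst hk
    rw [Pi.single_eq_same]
    omega
  · have hle := Finset.single_le_sum (f := α) (fun _ _ => Nat.zero_le _)
      (Finset.mem_erase.2 ⟨hk, Finset.mem_univ k⟩)
    rw [Pi.single_eq_of_ne hk]
    omega

theorem norm_fderiv_le_of_pderiv1 {d : ℕ} {g : EuclideanSpace ℝ (Fin d) → ℝ} {B : ℝ}
    (hB : 0 ≤ B) (x : EuclideanSpace ℝ (Fin d)) (h : ∀ i, |pderiv1 d i g x| ≤ B) :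
    ‖fderiv ℝ g x‖ ≤ d * B := by
  refine ContinuousLinearMap.opNorm_le_bound _ (by positivity) fun v => ?_
  have hv : v = ∑ i, v i • EuclideanSpace.single i (1 : ℝ) := by
    have := (EuclideanSpace.basisFun (Fin d) ℝ).sum_repr v
    simpa using this.symm
  have hL : fderiv ℝ g x v = ∑ i, v i * pderiv1 d i g x := by
    conv_lhs => rw [hv]
    simp [pderiv1]
  rw [hL]
  calc ‖∑ i, v i * pderiv1 d i g x‖ ≤ ∑ i, ‖v i * pderiv1 d i g x‖ := norm_sum_le _ _
    _ ≤ ∑ _i : Fin d, ‖v‖ * B := by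
        refine Finset.sum_le_sum fun i _ => ?_
        rw [norm_mul]
        exact mul_le_mul (PiLp.norm_apply_le v i) (h i) (norm_nonneg _) (norm_nonneg _)
    _ = d * B * ‖v‖ := by simp; ring

/-- A quantity bounded by `a 2^{-jβ} + b 2^{(1-β)j} r` for every `j ≥ 1`, where `0 < r ≤ 1`, is
at most a constant times `r^β`. -/
theorem abs_sub_le_of_dyadic {r a b β s : ℝ} (hβ0 : 0 < β) (ha : 0 ≤ a) (hb : 0 ≤ b)
    (hr : 0 < r) (hr1 : r ≤ 1)
    (h : ∀ j : ℕ, 1 ≤ j → s ≤ a * 2 ^ (-(j : ℝ) * β) + b * 2 ^ ((1 - β) * j) * r) :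
    s ≤ (a + 2 * b) * r ^ β := by
  obtain ⟨n, hn1, hn2⟩ := exists_nat_pow_near_of_lt_one hr hr1
    (by norm_num : (0 : ℝ) < 1 / 2) (by norm_num)
  set q : ℝ := (1 / 2) ^ (n + 1) with hq
  have hq0 : 0 < q := by positivity
  have hrq : r ≤ 2 * q := by rw [hq, pow_succ]; linarith
  have hpow : ∀ t : ℝ, (2 : ℝ) ^ (-((n + 1 : ℕ) : ℝ) * t) = q ^ t := fun t => by
    rw [Real.rpow_mul (by norm_num), Real.rpow_neg (by norm_num), Real.rpow_natCast, hq,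
      one_div, inv_pow]
  have h1 : (2 : ℝ) ^ (-((n + 1 : ℕ) : ℝ) * β) ≤ r ^ β := by
    rw [hpow]
    exact Real.rpow_le_rpow hq0.le hn1.le hβ0.le
  have h2 : (2 : ℝ) ^ ((1 - β) * ((n + 1 : ℕ) : ℝ)) * r ≤ 2 * r ^ β := by
    have he : (1 - β) * ((n + 1 : ℕ) : ℝ) = -((n + 1 : ℕ) : ℝ) * (β - 1) := by ring
    rw [he, hpow, Real.rpow_sub_one hq0.ne']
    have hqr : q ^ β ≤ r ^ β := Real.rpow_le_rpow hq0.le hn1.le hβ0.le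
    have hqβ : 0 ≤ q ^ β := by positivity
    rw [div_mul_eq_mul_div, div_le_iff₀ hq0]
    nlinarith
  calc s ≤ _ := h (n + 1) (by omega)
    _ = a * 2 ^ (-((n + 1 : ℕ) : ℝ) * β) + b * (2 ^ ((1 - β) * ((n + 1 : ℕ) : ℝ)) * r) := by
        ring
    _ ≤ a * r ^ β + b * (2 * r ^ β) := by gcongr
    _ = _ := by ring

theorem holder_of_memBesov {d : ℕ} {β : ℝ} (hβ : β ∈ Set.Ioo (0 : ℝ) 1)
    {f : EuclideanSpace ℝ (Fin d) → ℝ} (hfc : Continuous f) (hfb : ∃ M, ∀ x, |f x| ≤ M)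
    (hf : MemBesov d β 1 f) :
    ∃ C : ℝ, ∀ x y : EuclideanSpace ℝ (Fin d), x ≠ y → |f x - f y| ≤ C * ‖x - y‖ ^ β := by
  obtain ⟨M, hM⟩ := hfb
  obtain ⟨fs, hfs, ⟨C₁, h₁⟩, ⟨C₂, h₂⟩⟩ := hf
  have hM0 : 0 ≤ M := (abs_nonneg _).trans (hM 0)
  have hC1 : ∀ j : ℕ, 1 ≤ j → ∀ x, |f x - fs j x| ≤ |C₁| * 2 ^ (-(j : ℝ) * β) := by
    intro j hj
    refine abs_le_of_supNorm_le_ofReal (hfc.sub (hfs j hj).2.2.continuous) (by positivity)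
      ((h₁ j hj).trans (ENNReal.ofReal_le_ofReal ?_))
    gcongr
    exact le_abs_self _
  have hC2 : ∀ j : ℕ, 1 ≤ j → ∀ x, ‖fderiv ℝ (fs j) x‖ ≤ d * (|C₂| * 2 ^ ((1 - β) * j)) := by
    intro j hj x
    refine norm_fderiv_le_of_pderiv1 (by positivity) x fun i => ?_
    refine abs_le_of_supNorm_le_ofReal ?_ (by positivity) ?_ x
    · exact ((hfs j hj).2.2.continuous_fderiv (by simp)).clm_apply continuous_const
    · have := h₂ (Pi.single i 1) (by simp) j hj
      rw [pderivM_single, Nat.cast_one] at this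
      refine this.trans (ENNReal.ofReal_le_ofReal ?_)
      gcongr
      exact le_abs_self _
  refine ⟨2 * M + (2 * |C₁| + 2 * (d * |C₂|)), fun x y hxy => ?_⟩
  have hr : 0 < ‖x - y‖ := norm_pos_iff.2 (sub_ne_zero.2 hxy)
  have hrβ : 0 ≤ ‖x - y‖ ^ β := by positivity
  rcases le_or_gt ‖x - y‖ 1 with hr1 | hr1
  · have key : |f x - f y| ≤ (2 * |C₁| + 2 * (d * |C₂|)) * ‖x - y‖ ^ β := by
      refine abs_sub_le_of_dyadic hβ.1 (by positivity) (by positivity) hr hr1 fun j hj => ?_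
      have hx := hC1 j hj x
      have hy := hC1 j hj y
      have hxy' : |fs j x - fs j y| ≤ d * (|C₂| * 2 ^ ((1 - β) * j)) * ‖x - y‖ :=
        convex_univ.norm_image_sub_le_of_norm_fderiv_le
          (fun z _ => (hfs j hj).2.2.differentiable (by simp) z)
          (fun z _ => hC2 j hj z) (Set.mem_univ y) (Set.mem_univ x)
      rw [abs_le] at hx hy hxy' ⊢
      constructor <;> nlinarith
    nlinarith [mul_nonneg hM0 hrβ]
  · have h1 : 1 ≤ ‖x - y‖ ^ β := Real.one_le_rpow hr1.le hβ.1.le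
    have h2 : |f x - f y| ≤ 2 * M := by
      have hx := hM x
      have hy := hM y
      rw [abs_le] at *
      constructor <;> linarith
    have h3 : 0 ≤ 2 * |C₁| + 2 * (d * |C₂|) := by positivity
    nlinarith [mul_nonneg h3 hrβ]

/-- The derivative at `y` of the mollification of a continuous function `g` is controlled by the
oscillation of `g` on the unit ball around `y`. -/
theorem norm_fderiv_normed_convolution_le {E : Type*} [NormedAddCommGroup E]
    [InnerProductSpace ℝ E] [FiniteDimensional ℝ E] [MeasurableSpace E] [BorelSpace E]
    {μ : Measure E} [μ.IsAddHaarMeasure] (φ : ContDiffBump (0 : E))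
    {g : E → ℝ} (hg : Continuous g) {D : ℝ} (y : E)
    (hD : ∀ t ∈ Metric.closedBall (0 : E) φ.rOut, |g (y - t) - g y| ≤ D) :
    ‖fderiv ℝ (φ.normed μ ⋆[ContinuousLinearMap.lsmul ℝ ℝ, μ] g : E → ℝ) y‖ ≤
      (∫ t, ‖fderiv ℝ (φ.normed μ) t‖ ∂μ) * D := by
  have hφ : HasCompactSupport (φ.normed μ) := φ.hasCompactSupport_normed
  have hφs : ContDiff ℝ 1 (φ.normed μ) := φ.contDiff_normed (n := 1)
  have hgs : Continuous fun z => g z - g y := hg.sub continuous_const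
  have hsplit : (φ.normed μ ⋆[ContinuousLinearMap.lsmul ℝ ℝ, μ] g : E → ℝ) =
      fun x => (φ.normed μ ⋆[ContinuousLinearMap.lsmul ℝ ℝ, μ] (fun z => g z - g y) : E → ℝ) x
        + g y := by
    funext x
    have hi : Integrable (fun t => φ.normed μ t * g (x - t)) μ :=
      (hφs.continuous.mul (hg.comp (continuous_const.sub continuous_id))
        ).integrable_of_hasCompactSupport hφ.mul_right
    have hi' : Integrable (fun t => φ.normed μ t * g y) μ := φ.integrable_normed.mul_const _
    simp only [convolution_lsmul, smul_eq_mul, mul_sub]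
    rw [integral_sub hi hi', integral_mul_const, φ.integral_normed]
    ring
  have hder := hφ.hasFDerivAt_convolution_left (ContinuousLinearMap.lsmul ℝ ℝ) (μ := μ) hφs
    hgs.locallyIntegrable y
  rw [hsplit, fderiv_add_const, hder.fderiv, convolution_def, ← integral_mul_const]
  refine norm_integral_le_of_norm_le ?_ (Filter.Eventually.of_forall fun t => ?_)
  · exact (((hφs.continuous_fderiv (by simp)).norm).integrable_of_hasCompactSupport
      (hφ.fderiv (𝕜 := ℝ)).norm).mul_const _
  · by_cases ht : t ∈ Metric.closedBall (0 : E) φ.rOut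
    · have heq : (ContinuousLinearMap.lsmul ℝ ℝ).precompL E (fderiv ℝ (φ.normed μ) t)
          (g (y - t) - g y) = (g (y - t) - g y) • fderiv ℝ (φ.normed μ) t := by
        ext v
        simp [sub_mul, mul_comm]
      rw [heq, norm_smul, mul_comm]
      exact mul_le_mul_of_nonneg_left (hD t ht) (norm_nonneg _)
    · have h0 : fderiv ℝ (φ.normed μ) t = 0 := by
        by_contra hne
        refine ht ?_
        rw [← φ.tsupport_normed_eq (μ := μ)]
        exact support_fderiv_subset ℝ hne
      simp [h0]

theorem memBesov_of_holder {d : ℕ} {β : ℝ} (hβ : 0 < β)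
    {f : EuclideanSpace ℝ (Fin d) → ℝ} (hfc : Continuous f)
    (hfb : ∃ M, ∀ x, |f x| ≤ M) (hper : Per1 d f) {C : ℝ} (hC0 : 0 ≤ C)
    (hC : ∀ x y : EuclideanSpace ℝ (Fin d), |f x - f y| ≤ C * ‖x - y‖ ^ β) :
    MemBesov d β 1 f := by
  obtain ⟨M, hM⟩ := hfb
  let φ : ContDiffBump (0 : EuclideanSpace ℝ (Fin d)) := ⟨1 / 2, 1, by norm_num, by norm_num⟩
  let h : ℕ → ℝ := fun j => 2 ^ (-(j : ℝ))
  have hh : ∀ j, 0 < h j := fun j => Real.rpow_pos_of_pos (by norm_num) _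
  let g : ℕ → EuclideanSpace ℝ (Fin d) → ℝ := fun j y => f (h j • y)
  let F : ℕ → EuclideanSpace ℝ (Fin d) → ℝ := fun j =>
    (φ.normed volume ⋆[ContinuousLinearMap.lsmul ℝ ℝ, volume] g j)
  let A : ℝ := ∫ t, ‖fderiv ℝ (φ.normed (volume : Measure (EuclideanSpace ℝ (Fin d)))) t‖
  have hgc : ∀ j, Continuous (g j) := fun j => hfc.comp (continuous_const_smul _)
  have hgosc : ∀ j y z, ‖y - z‖ ≤ 1 → |g j y - g j z| ≤ C * h j ^ β := by
    intro j y z hyz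
    refine (hC _ _).trans ?_
    rw [← smul_sub, norm_smul, Real.norm_of_nonneg (hh j).le]
    gcongr
    exact mul_le_of_le_one_right (hh j).le hyz
  have hFs : ∀ j, ContDiff ℝ 1 (F j) := fun j =>
    φ.hasCompactSupport_normed.contDiff_convolution_left _ (φ.contDiff_normed (n := 1))
      (hgc j).locallyIntegrable
  have hFg : ∀ j y, |F j y - g j y| ≤ C * h j ^ β := fun j y =>
    φ.dist_normed_convolution_le (hgc j).aestronglyMeasurable fun z hz =>
      hgosc j z y (mem_ball_iff_norm.1 hz).le
  have hFd : ∀ j y, ‖fderiv ℝ (F j) y‖ ≤ A * (C * h j ^ β) := fun j y =>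
    norm_fderiv_normed_convolution_le φ (hgc j) y fun t ht =>
      hgosc j _ _ (by simpa using ht)
  have hclose : ∀ j x, |f x - F j ((h j)⁻¹ • x)| ≤ C * h j ^ β := by
    intro j x
    have := hFg j ((h j)⁻¹ • x)
    rwa [abs_sub_comm, show g j ((h j)⁻¹ • x) = f x by
      simp only [g, smul_inv_smul₀ (hh j).ne']] at this
  refine ⟨fun j x => F j ((h j)⁻¹ • x), fun j _ => ⟨⟨M + C * h j ^ β, fun x => ?_⟩, ?_, ?_⟩,
    ⟨C, fun j _ => supNorm_le_ofReal fun x => ?_⟩, ⟨A * C, fun α hα j _ => ?_⟩⟩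
  · have h1 := hclose j x
    have h2 := hM x
    rw [abs_le] at *
    constructor <;> linarith
  · intro x i
    simp only [F, convolution_lsmul, g, smul_sub, smul_inv_smul₀ (hh j).ne']
    congr 1
    funext t
    rw [add_sub_right_comm, hper]
  · rw [Nat.cast_one]
    exact (hFs j).comp (contDiff_const_smul (h j)⁻¹)
  · rw [Real.rpow_mul (by norm_num)]
    exact hclose j x
  · obtain ⟨i, rfl⟩ := exists_eq_single_of_sum_eq_one hα
    rw [pderivM_single]
    refine supNorm_le_ofReal fun x => ?_
    have he : A * C * (2 : ℝ) ^ ((((1 : ℕ) : ℝ) - β) * j) = (h j)⁻¹ * (A * (C * h j ^ β)) := by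
      have : (2 : ℝ) ^ ((((1 : ℕ) : ℝ) - β) * j) = h j ^ β / h j := by
        rw [← Real.rpow_sub_one (hh j).ne', ← Real.rpow_mul (by norm_num)]
        push_cast
        ring_nf
      rw [this]
      ring
    rw [he, pderiv1, fderiv_comp_smul, ← Real.norm_eq_abs]
    refine (ContinuousLinearMap.le_opNorm _ _).trans ?_
    rw [PiLp.norm_single, norm_one, mul_one, norm_smul, norm_inv,
      Real.norm_of_nonneg (hh j).le]
    exact mul_le_mul_of_nonneg_left (hFd j _) (inv_nonneg.2 (hh j).le)

/-- Meyer's characterization (Proposition 2, case `0 < β < 1`): a continuous bounded 1-periodic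
function belongs to `B^β_{∞,∞}` in the approximation sense iff it is `β`-Hölder. -/
theorem besov_iff_holder (d : ℕ) (hd : 1 ≤ d) (β : ℝ) (hβ : β ∈ Set.Ioo (0 : ℝ) 1)
    (f : EuclideanSpace ℝ (Fin d) → ℝ) (hfc : Continuous f)
    (hfb : ∃ M, ∀ x, |f x| ≤ M) (hper : Per1 d f) :
    MemBesov d β 1 f ↔
      ∃ C : ℝ, ∀ x y : EuclideanSpace ℝ (Fin d), x ≠ y →
        |f x - f y| ≤ C * ‖x - y‖ ^ β := by
  constructor
  · exact holder_of_memBesov hβ hfc hfb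
  · rintro ⟨C, hC⟩
    refine memBesov_of_holder hβ.1 hfc hfb hper (abs_nonneg C) fun x y => ?_
    by_cases hxy : x = y
    · simp [hxy, Real.zero_rpow hβ.1.ne']
    · refine (hC x y hxy).trans ?_
      gcongr
      exact le_abs_self C
end
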